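/- arXiv:2309.10578 — 8 statements merged into one kernel-verified Lean document; each statement's English description precedes it below -/
import Mathlib

section
/- Assume G is orderable and φ is cofinal. Then for all ψ, ψ' ∈ G one has the triangle inequalities c₊(ψ*ψ') ≤ c₊(ψ) + c₊(ψ') and c₋(ψ*ψ') ≥ c₋(ψ) + c₋(ψ'). (Triangle inequalities for the selectors, Theorem 1.2(3) of the paper.) -/
/-- The maximal order spectral selector `c₊`. -/
noncomputable def cplus {G : Type*} (r : G → G → Prop) (φ : ℝ → G) (ψ : G) : ℝ :=
  sInf {t : ℝ | r ψ (φ t)}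

/-- The minimal order spectral selector `c₋`. -/
noncomputable def cminus {G : Type*} (r : G → G → Prop) (φ : ℝ → G) (ψ : G) : ℝ :=
  sSup {t : ℝ | r (φ t) ψ}

/-- triangle inequalities for the order spectral selectors. -/
theorem stmt_2 {G : Type*} [Group G] (r : G → G → Prop)
    (hrefl : ∀ x, r x x)
    (htrans : ∀ x y z, r x y → r y z → r x z)
    (hbi : ∀ a b x y, r x y → r (a * x * b) (a * y * b))
    (φ : ℝ → G)
    (hφadd : ∀ s t : ℝ, φ (s + t) = φ s * φ t)
    (hφinj : Function.Injective φ)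
    (hφmono : ∀ s t : ℝ, s ≤ t → r (φ s) (φ t))
    (horder : ∀ x y, r x y → r y x → x = y)
    (hcof : ∀ ψ : G, ∃ s t : ℝ, r (φ s) ψ ∧ r ψ (φ t)) :
    ∀ ψ ψ' : G,
      cplus r φ (ψ * ψ') ≤ cplus r φ ψ + cplus r φ ψ' ∧
      cminus r φ ψ + cminus r φ ψ' ≤ cminus r φ (ψ * ψ') := by
  have hmul : ∀ a b c d, r a b → r c d → r (a * c) (b * d) := fun a b c d hab hcd =>
    htrans _ (b * c) _ (by simpa using hbi 1 c a b hab) (by simpa using hbi b 1 c d hcd)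
  have hle : ∀ s t ψ, r (φ s) ψ → r ψ (φ t) → s ≤ t := by
    intro s t ψ hs ht
    by_contra! hlt
    exact hlt.ne (hφinj (horder _ _ (hφmono t s hlt.le) (htrans _ _ _ hs ht)))
  have hbelow : ∀ ψ, BddBelow {t : ℝ | r ψ (φ t)} := fun ψ =>
    let ⟨s, _, hs, _⟩ := hcof ψ
    ⟨s, fun t ht => hle s t ψ hs ht⟩
  have habove : ∀ ψ, BddAbove {t : ℝ | r (φ t) ψ} := fun ψ =>
    let ⟨_, t, _, ht⟩ := hcof ψ
    ⟨t, fun s hs => hle s t ψ hs ht⟩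
  have hupper : ∀ ψ, {t : ℝ | r ψ (φ t)}.Nonempty := fun ψ =>
    let ⟨_, t, _, ht⟩ := hcof ψ
    ⟨t, ht⟩
  have hlower : ∀ ψ, {t : ℝ | r (φ t) ψ}.Nonempty := fun ψ =>
    let ⟨s, _, hs, _⟩ := hcof ψ
    ⟨s, hs⟩
  intro ψ ψ'
  unfold cplus cminus
  constructor
  · rw [← csInf_add (hupper ψ) (hbelow ψ) (hupper ψ') (hbelow ψ')]
    refine csInf_le_csInf (hbelow _) ((hupper ψ).add (hupper ψ')) ?_
    rintro _ ⟨t, ht, t', ht', rfl⟩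
    simpa only [Set.mem_ofPred_eq, hφadd] using hmul _ _ _ _ ht ht'
  · rw [← csSup_add (hlower ψ) (habove ψ) (hlower ψ') (habove ψ')]
    refine csSup_le_csSup (habove _) ((hlower ψ).add (hlower ψ')) ?_
    rintro _ ⟨t, ht, t', ht', rfl⟩
    simpa only [Set.mem_ofPred_eq, hφadd] using hmul _ _ _ _ ht ht'
end

section
/- Let G be a group with a bi-invariant partial order ⪯, let φ, χ : ℝ → G be injective monotone cofinal group homomorphisms, and write c₊^φ(ψ) := sInf {t : ℝ | ψ ⪯ φ(t)} and c₊^χ(ψ) := sInf {t : ℝ | ψ ⪯ χ(t)}. Suppose there are real numbers 0 < m ≤ M with χ(m*t) ⪯ φ(t) ⪯ χ(M*t) for every t ≥ 0 and χ(M*t) ⪯ φ(t) ⪯ χ(m*t) for every t ≤ 0. Then for every ψ ∈ G: if c₊^χ(ψ) ≥ 0 then m·c₊^φ(ψ) ≤ c₊^χ(ψ) ≤ M·c₊^φ(ψ), and if c₊^χ(ψ) ≤ 0 then M·c₊^φ(ψ) ≤ c₊^χ(ψ) ≤ m·c₊^φ(ψ). In particular c₊^φ(ψ) < 0 (resp.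 = 0, resp. > 0) if and only if c₊^χ(ψ) < 0 (resp. = 0, resp. > 0). (Sign invariance of the selectors under a change of contact form β = e^f α, with m = e^{inf f} and M = e^{sup f}; Lemma 3.4 of the paper.) -/
theorem cplus_le {G : Type*} {r : G → G → Prop}
    (htrans : ∀ x y z, r x y → r y z → r x z) (horder : ∀ x y, r x y → r y x → x = y)
    {φ : ℝ → G} (hinj : Function.Injective φ) (hmono : ∀ s t : ℝ, s ≤ t → r (φ s) (φ t))
    (hcof : ∀ ψ : G, ∃ s t : ℝ, r (φ s) ψ ∧ r ψ (φ t)) {ψ : G} {t : ℝ} (h : r ψ (φ t)) :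
    cplus r φ ψ ≤ t := by
  obtain ⟨s, -, hs, -⟩ := hcof ψ
  refine csInf_le ⟨s, fun u hu => ?_⟩ h
  by_contra! hus
  exact hus.ne (hinj (horder _ _ (hmono u s hus.le) (htrans _ _ _ hs hu)))

theorem rel_of_cplus_lt {G : Type*} {r : G → G → Prop}
    (htrans : ∀ x y z, r x y → r y z → r x z)
    {φ : ℝ → G} (hmono : ∀ s t : ℝ, s ≤ t → r (φ s) (φ t))
    (hcof : ∀ ψ : G, ∃ s t : ℝ, r (φ s) ψ ∧ r ψ (φ t)) {ψ : G} {t : ℝ}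
    (h : cplus r φ ψ < t) : r ψ (φ t) := by
  obtain ⟨-, u, -, hu⟩ := hcof ψ
  obtain ⟨v, hv, hvt⟩ := exists_lt_of_csInf_lt (s := {t : ℝ | r ψ (φ t)}) ⟨u, hu⟩ h
  exact htrans _ _ _ hv (hmono v t hvt.le)

/-- sign invariance/comparison of the selectors associated to two
commensurable flows `φ` and `χ` (change of contact form `β = e^f α`,
with `m = e^{inf f}` and `M = e^{sup f}`). -/
theorem stmt_4 {G : Type*} [Group G] (r : G → G → Prop)
    (hrefl : ∀ x, r x x)
    (htrans : ∀ x y z, r x y → r y z → r x z)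
    (hbi : ∀ a b x y, r x y → r (a * x * b) (a * y * b))
    (horder : ∀ x y, r x y → r y x → x = y)
    (φ χ : ℝ → G)
    (hφadd : ∀ s t : ℝ, φ (s + t) = φ s * φ t)
    (hχadd : ∀ s t : ℝ, χ (s + t) = χ s * χ t)
    (hφinj : Function.Injective φ) (hχinj : Function.Injective χ)
    (hφmono : ∀ s t : ℝ, s ≤ t → r (φ s) (φ t))
    (hχmono : ∀ s t : ℝ, s ≤ t → r (χ s) (χ t))
    (hφcof : ∀ ψ : G, ∃ s t : ℝ, r (φ s) ψ ∧ r ψ (φ t))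
    (hχcof : ∀ ψ : G, ∃ s t : ℝ, r (χ s) ψ ∧ r ψ (χ t))
    (m M : ℝ) (hm : 0 < m) (hmM : m ≤ M)
    (hcompnn : ∀ t : ℝ, 0 ≤ t → r (χ (m * t)) (φ t) ∧ r (φ t) (χ (M * t)))
    (hcompnp : ∀ t : ℝ, t ≤ 0 → r (χ (M * t)) (φ t) ∧ r (φ t) (χ (m * t))) :
    ∀ ψ : G,
      (0 ≤ cplus r χ ψ →
        m * cplus r φ ψ ≤ cplus r χ ψ ∧ cplus r χ ψ ≤ M * cplus r φ ψ) ∧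
      (cplus r χ ψ ≤ 0 →
        M * cplus r φ ψ ≤ cplus r χ ψ ∧ cplus r χ ψ ≤ m * cplus r φ ψ) ∧
      (cplus r φ ψ < 0 ↔ cplus r χ ψ < 0) ∧
      (cplus r φ ψ = 0 ↔ cplus r χ ψ = 0) ∧
      (0 < cplus r φ ψ ↔ 0 < cplus r χ ψ) := by
  intro ψ
  have hM : 0 < M := hm.trans_le hmM
  have hφle : ∀ t, r ψ (φ t) → cplus r φ ψ ≤ t :=
    fun t => cplus_le htrans horder hφinj hφmono hφcof
  have hχle : ∀ t, r ψ (χ t) → cplus r χ ψ ≤ t :=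
    fun t => cplus_le htrans horder hχinj hχmono hχcof
  have hφlt : ∀ t, cplus r φ ψ < t → r ψ (φ t) :=
    fun t => rel_of_cplus_lt htrans hφmono hφcof
  have hχlt : ∀ t, cplus r χ ψ < t → r ψ (χ t) :=
    fun t => rel_of_cplus_lt htrans hχmono hχcof
  have hφχnn : ∀ t, 0 ≤ t → cplus r φ ψ < t → cplus r χ ψ ≤ M * t :=
    fun t ht h => hχle _ (htrans _ _ _ (hφlt t h) (hcompnn t ht).2)
  have hφχnp : ∀ t, t ≤ 0 → cplus r φ ψ < t → cplus r χ ψ ≤ m * t :=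
    fun t ht h => hχle _ (htrans _ _ _ (hφlt t h) (hcompnp t ht).2)
  have hχφnn : ∀ t, 0 ≤ t → cplus r χ ψ < m * t → cplus r φ ψ ≤ t :=
    fun t ht h => hφle _ (htrans _ _ _ (hχlt _ h) (hcompnn t ht).1)
  have hχφnp : ∀ t, t ≤ 0 → cplus r χ ψ < M * t → cplus r φ ψ ≤ t :=
    fun t ht h => hφle _ (htrans _ _ _ (hχlt _ h) (hcompnp t ht).1)
  generalize cplus r φ ψ = a at *
  generalize cplus r χ ψ = b at *
  have hnn : 0 ≤ b → m * a ≤ b ∧ b ≤ M * a := by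
    intro hb
    constructor
    · by_contra! h
      obtain ⟨t, hbt, hta⟩ := exists_between ((div_lt_iff₀' hm).2 h)
      have ht : 0 ≤ t := (div_nonneg hb hm.le).trans hbt.le
      exact (hχφnn t ht ((div_lt_iff₀' hm).1 hbt)).not_gt hta
    · by_contra! h
      obtain ⟨t, hat, htb⟩ := exists_between ((lt_div_iff₀' hM).2 h)
      rw [lt_div_iff₀' hM] at htb
      rcases le_or_gt 0 t with ht | ht
      · exact (hφχnn t ht hat).not_gt htb
      · linarith [hφχnp t ht.le hat, mul_neg_of_pos_of_neg hm ht]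
  have hnp : b ≤ 0 → M * a ≤ b ∧ b ≤ m * a := by
    intro hb
    have hMa : M * a ≤ b := by
      rcases hb.eq_or_lt with rfl | hb
      · exact mul_nonpos_of_nonneg_of_nonpos hM.le
          (nonpos_of_mul_nonpos_right (hnn le_rfl).1 hm)
      · by_contra! h
        obtain ⟨t, hbt, hta⟩ := exists_between ((div_lt_iff₀' hM).2 h)
        rw [div_lt_iff₀' hM] at hbt
        rcases le_or_gt t 0 with ht | ht
        · exact (hχφnp t ht hbt).not_gt hta
        · linarith [hχφnp 0 le_rfl (by simpa using hb)]
    refine ⟨hMa, ?_⟩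
    by_contra! h
    have ha : a < 0 := by
      by_contra! ha
      linarith [mul_nonneg hm.le ha]
    obtain ⟨t, hat, htb⟩ := exists_between ((lt_div_iff₀' hm).2 h)
    have ht : t ≤ 0 := htb.le.trans (div_nonpos_of_nonpos_of_nonneg hb hm.le)
    exact (hφχnp t ht hat).not_gt ((lt_div_iff₀' hm).1 htb)
  have hneg : b < 0 → a < 0 := fun hb =>
    neg_of_mul_neg_right ((hnp hb.le).1.trans_lt hb) hM.le
  have hpos : 0 < b → 0 < a := fun hb =>
    pos_of_mul_pos_right (hb.trans_le (hnn hb.le).2) hM.le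
  have hzero : b = 0 → a = 0 := by
    rintro rfl
    exact le_antisymm (nonpos_of_mul_nonpos_right (hnn le_rfl).1 hm)
      (nonneg_of_mul_nonneg_right (hnn le_rfl).2 hM)
  refine ⟨hnn, hnp, ?_⟩
  rcases lt_trichotomy b 0 with hb | hb | hb
  · have := hneg hb
    grind
  · have := hzero hb
    grind
  · have := hpos hb
    grind
end

section
/- Assume G is orderable, φ is cofinal, and the selectors are non-degenerate. Then for every ψ ∈ G with 1 ⪯ ψ and ψ ≠ 1 one has c₊(ψ) > 0. (Positivity of the selector on nontrivial non-negative elements, Corollary 3.14 of the paper.) -/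
/-- positivity of `c₊` on nontrivial non-negative elements,
assuming orderability, cofinality and non-degeneracy of the selectors. -/
theorem stmt_6 {G : Type*} [Group G] (r : G → G → Prop)
    (hrefl : ∀ x, r x x)
    (htrans : ∀ x y z, r x y → r y z → r x z)
    (hbi : ∀ a b x y, r x y → r (a * x * b) (a * y * b))
    (φ : ℝ → G)
    (hφadd : ∀ s t : ℝ, φ (s + t) = φ s * φ t)
    (hφinj : Function.Injective φ)
    (hφmono : ∀ s t : ℝ, s ≤ t → r (φ s) (φ t))
    (horder : ∀ x y, r x y → r y x → x = y)
    (hcof : ∀ ψ : G, ∃ s t : ℝ, r (φ s) ψ ∧ r ψ (φ t))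
    (hnondeg : ∀ (ψ : G) (t : ℝ), cminus r φ ψ = t → cplus r φ ψ = t → ψ = φ t) :
    ∀ ψ : G, r 1 ψ → ψ ≠ 1 → 0 < cplus r φ ψ := by
  intro ψ hψ hne
  have hφ0 : φ 0 = 1 := by simpa using hφadd 0 0
  have le_of_rel : ∀ s t : ℝ, r (φ s) ψ → r ψ (φ t) → s ≤ t := by
    intro s t hs ht
    by_contra! hlt
    exact hlt.ne (hφinj (horder _ _ (hφmono _ _ hlt.le) (htrans _ _ _ hs ht)))
  obtain ⟨a, b, ha, hb⟩ := hcof ψ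
  have h0 : 0 ≤ cminus r φ ψ :=
    le_csSup ⟨b, fun s hs => le_of_rel s b hs hb⟩ (show r (φ 0) ψ by rwa [hφ0])
  have hle : cminus r φ ψ ≤ cplus r φ ψ :=
    csSup_le ⟨a, ha⟩ fun s hs => le_csInf ⟨b, hb⟩ fun t ht => le_of_rel s t hs ht
  by_contra! hc
  exact hne ((hnondeg ψ 0 (by linarith) (by linarith)).trans hφ0)
end

section
/- Assume G is orderable and φ is cofinal, and define the spectral norm ν(ψ) := max (c₊(ψ), c₊(ψ⁻¹)). Then ν(1) = 0, ν(ψ) ≥ 0 for all ψ, ν(ψ) = ν(ψ⁻¹) for all ψ, and ν(x*y) ≤ ν(x) + ν(y) for all x, y ∈ G; moreover, if the selectors are non-degenerate, then ν(ψ) = 0 implies ψ = 1. (The spectral norm is a non-degenerate group pseudo-norm; Section 3.2 and Corollary 3.7 of the paper.) -/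
/-- The spectral norm `ν(ψ) = max (c₊(ψ), c₊(ψ⁻¹))`. -/
noncomputable def specNorm {G : Type*} [Group G] (r : G → G → Prop) (φ : ℝ → G) (ψ : G) : ℝ :=
  max (cplus r φ ψ) (cplus r φ ψ⁻¹)

section OrderSelectors

variable {G : Type*} {r : G → G → Prop} {φ : ℝ → G}

theorem map_zero_eq_one [Group G] (hφadd : ∀ s t : ℝ, φ (s + t) = φ s * φ t) : φ 0 = 1 := by
  have h := hφadd 0 0
  rw [add_zero] at h
  exact left_eq_mul.mp h

theorem map_neg_eq_inv [Group G] (hφadd : ∀ s t : ℝ, φ (s + t) = φ s * φ t) (t : ℝ) :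
    φ (-t) = (φ t)⁻¹ := by
  rw [eq_inv_iff_mul_eq_one, ← hφadd, neg_add_cancel, map_zero_eq_one hφadd]

theorem rel_inv [Group G] (hbi : ∀ a b x y, r x y → r (a * x * b) (a * y * b)) {x y : G}
    (h : r x y) : r y⁻¹ x⁻¹ := by
  simpa using hbi x⁻¹ y⁻¹ x y h

theorem rel_mul [Group G] (htrans : ∀ x y z, r x y → r y z → r x z)
    (hbi : ∀ a b x y, r x y → r (a * x * b) (a * y * b)) {a b c d : G}
    (hab : r a b) (hcd : r c d) : r (a * c) (b * d) := by
  refine htrans _ (b * c) _ ?_ ?_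
  · simpa using hbi 1 c a b hab
  · simpa using hbi b 1 c d hcd

theorem le_of_rel_map (hφinj : Function.Injective φ)
    (hφmono : ∀ s t : ℝ, s ≤ t → r (φ s) (φ t))
    (horder : ∀ x y, r x y → r y x → x = y) {s t : ℝ} (h : r (φ s) (φ t)) : s ≤ t := by
  by_contra! hts
  exact hts.ne' (hφinj (horder _ _ h (hφmono t s hts.le)))

theorem cplus_map (hφinj : Function.Injective φ)
    (hφmono : ∀ s t : ℝ, s ≤ t → r (φ s) (φ t))
    (horder : ∀ x y, r x y → r y x → x = y) (s : ℝ) : cplus r φ (φ s) = s := by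
  have h : {t : ℝ | r (φ s) (φ t)} = Set.Ici s :=
    Set.ext fun t => ⟨le_of_rel_map hφinj hφmono horder, hφmono s t⟩
  rw [cplus, h, csInf_Ici]

theorem bddBelow_setOf_rel_map (htrans : ∀ x y z, r x y → r y z → r x z)
    (hφinj : Function.Injective φ)
    (hφmono : ∀ s t : ℝ, s ≤ t → r (φ s) (φ t))
    (horder : ∀ x y, r x y → r y x → x = y)
    (hcof : ∀ ψ : G, ∃ s t : ℝ, r (φ s) ψ ∧ r ψ (φ t)) (ψ : G) :
    BddBelow {t : ℝ | r ψ (φ t)} := by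
  obtain ⟨s, -, hs, -⟩ := hcof ψ
  exact ⟨s, fun t ht => le_of_rel_map hφinj hφmono horder (htrans _ _ _ hs ht)⟩

theorem nonempty_setOf_rel_map (hcof : ∀ ψ : G, ∃ s t : ℝ, r (φ s) ψ ∧ r ψ (φ t)) (ψ : G) :
    {t : ℝ | r ψ (φ t)}.Nonempty := by
  obtain ⟨-, t, -, ht⟩ := hcof ψ
  exact ⟨t, ht⟩

theorem cplus_mul_le [Group G] (htrans : ∀ x y z, r x y → r y z → r x z)
    (hbi : ∀ a b x y, r x y → r (a * x * b) (a * y * b))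
    (hφadd : ∀ s t : ℝ, φ (s + t) = φ s * φ t)
    (hφinj : Function.Injective φ)
    (hφmono : ∀ s t : ℝ, s ≤ t → r (φ s) (φ t))
    (horder : ∀ x y, r x y → r y x → x = y)
    (hcof : ∀ ψ : G, ∃ s t : ℝ, r (φ s) ψ ∧ r ψ (φ t)) (x y : G) :
    cplus r φ (x * y) ≤ cplus r φ x + cplus r φ y := by
  have key : ∀ s t : ℝ, r x (φ s) → r y (φ t) → cplus r φ (x * y) ≤ s + t := by
    intro s t hs ht
    refine csInf_le (bddBelow_setOf_rel_map htrans hφinj hφmono horder hcof _) ?_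
    rw [Set.mem_ofPred_eq, hφadd]
    exact rel_mul htrans hbi hs ht
  rw [← sub_le_iff_le_add]
  refine le_csInf (nonempty_setOf_rel_map hcof x) fun s hs => ?_
  rw [sub_le_comm]
  refine le_csInf (nonempty_setOf_rel_map hcof y) fun t ht => ?_
  linarith [key s t hs ht]

theorem cminus_eq_neg_cplus_inv [Group G] (hbi : ∀ a b x y, r x y → r (a * x * b) (a * y * b))
    (hφadd : ∀ s t : ℝ, φ (s + t) = φ s * φ t) (ψ : G) :
    cminus r φ ψ = -cplus r φ ψ⁻¹ := by
  have h : {t : ℝ | r (φ t) ψ} = -{t : ℝ | r ψ⁻¹ (φ t)} := by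
    ext t
    simp only [Set.mem_neg, Set.mem_ofPred_eq, map_neg_eq_inv hφadd]
    exact ⟨rel_inv hbi, fun h => by simpa using rel_inv hbi h⟩
  rw [cminus, cplus, h, Real.sInf_def, neg_neg]

end OrderSelectors

/-- the spectral norm is a group pseudo-norm, non-degenerate
whenever the selectors are non-degenerate. -/
theorem stmt_8 {G : Type*} [Group G] (r : G → G → Prop)
    (hrefl : ∀ x, r x x)
    (htrans : ∀ x y z, r x y → r y z → r x z)
    (hbi : ∀ a b x y, r x y → r (a * x * b) (a * y * b))
    (φ : ℝ → G)
    (hφadd : ∀ s t : ℝ, φ (s + t) = φ s * φ t)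
    (hφinj : Function.Injective φ)
    (hφmono : ∀ s t : ℝ, s ≤ t → r (φ s) (φ t))
    (horder : ∀ x y, r x y → r y x → x = y)
    (hcof : ∀ ψ : G, ∃ s t : ℝ, r (φ s) ψ ∧ r ψ (φ t)) :
    specNorm r φ (1 : G) = 0 ∧
    (∀ ψ : G, 0 ≤ specNorm r φ ψ) ∧
    (∀ ψ : G, specNorm r φ ψ = specNorm r φ ψ⁻¹) ∧
    (∀ x y : G, specNorm r φ (x * y) ≤ specNorm r φ x + specNorm r φ y) ∧
    ((∀ (ψ : G) (t : ℝ), cminus r φ ψ = t → cplus r φ ψ = t → ψ = φ t) →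
      ∀ ψ : G, specNorm r φ ψ = 0 → ψ = 1) := by
  have hone : cplus r φ (1 : G) = 0 := by
    rw [← map_zero_eq_one hφadd, cplus_map hφinj hφmono horder]
  have hmul := cplus_mul_le htrans hbi hφadd hφinj hφmono horder hcof
  have hsum : ∀ ψ : G, 0 ≤ cplus r φ ψ + cplus r φ ψ⁻¹ := fun ψ => by
    simpa [hone] using hmul ψ ψ⁻¹
  refine ⟨by simp [specNorm, hone], fun ψ => ?_, fun ψ => ?_, fun x y => ?_, fun hnd ψ hψ => ?_⟩
  · rw [specNorm, le_max_iff]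
    by_contra! h
    linarith [hsum ψ]
  · rw [specNorm, specNorm, inv_inv, max_comm]
  · refine max_le ((hmul x y).trans (add_le_add (le_max_left _ _) (le_max_left _ _))) ?_
    rw [mul_inv_rev, add_comm]
    exact (hmul y⁻¹ x⁻¹).trans (add_le_add (le_max_right _ _) (le_max_right _ _))
  · obtain ⟨h₁, h₂⟩ := max_le_iff.mp hψ.le
    have h := hsum ψ
    rw [← map_zero_eq_one hφadd]
    refine hnd ψ 0 ?_ (by linarith)
    rw [cminus_eq_neg_cplus_inv hbi hφadd]
    linarith
end

section
/- Assume the ℝ-action on X is cofinal. Then for all x, y ∈ X the set {t : ℝ | x ⪯ t•y} is nonempty and bounded below, the set {t : ℝ | t•y ⪯ x} is nonempty and bounded above, and ℓ₋(x, y) ≤ ℓ₊(x, y). In particular the Legendrian order spectral selectors ℓ₊ and ℓ₋ are well-defined real-valued functions on X × X. (Real-valuedness of the Legendrian selectors, preamble of Theorem 1.1 of the paper.) -/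
/-- The maximal Legendrian order spectral selector `ℓ₊`. -/
noncomputable def lplus {X : Type*} (r : X → X → Prop) (act : ℝ → X → X) (x y : X) : ℝ :=
  sInf {t : ℝ | r x (act t y)}

/-- The minimal Legendrian order spectral selector `ℓ₋`. -/
noncomputable def lminus {X : Type*} (r : X → X → Prop) (act : ℝ → X → X) (x y : X) : ℝ :=
  sSup {t : ℝ | r (act t y) x}

/-- Along an orbit of a free, monotone action, the order reflects the order of `ℝ`. -/
theorem le_of_rel_act {X : Type*} {r : X → X → Prop}
    (hantisymm : ∀ x y, r x y → r y x → x = y) {act : ℝ → X → X}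
    (hactadd : ∀ (s t : ℝ) (x : X), act (s + t) x = act s (act t x))
    (hflowmono : ∀ s t : ℝ, s ≤ t → ∀ x : X, r (act s x) (act t x))
    (hfree : ∀ (t : ℝ) (x : X), act t x = x → t = 0)
    {s t : ℝ} {y : X} (h : r (act s y) (act t y)) : s ≤ t := by
  by_contra! hts
  have heq := hantisymm _ _ h (hflowmono t s hts.le y)
  have hzero : s - t = 0 := hfree _ (act t y) (by rw [← hactadd, sub_add_cancel, heq])
  linarith

/-- if the ℝ-action (Reeb flow) is cofinal, the defining sets of
the Legendrian selectors are nonempty and appropriately bounded, and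
`ℓ₋ ≤ ℓ₊`; in particular the selectors are real-valued. -/
theorem stmt_13 {X : Type*} (r : X → X → Prop)
    (hrefl : ∀ x, r x x)
    (htrans : ∀ x y z, r x y → r y z → r x z)
    (hantisymm : ∀ x y, r x y → r y x → x = y)
    (act : ℝ → X → X)
    (hact0 : ∀ x, act 0 x = x)
    (hactadd : ∀ (s t : ℝ) (x : X), act (s + t) x = act s (act t x))
    (hactmono : ∀ (t : ℝ) (x y : X), r x y → r (act t x) (act t y))
    (hflowmono : ∀ s t : ℝ, s ≤ t → ∀ x : X, r (act s x) (act t x))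
    (hfree : ∀ (t : ℝ) (x : X), act t x = x → t = 0)
    (hcof : ∀ x y : X, ∃ s t : ℝ, r (act s y) x ∧ r x (act t y)) :
    ∀ x y : X,
      ({t : ℝ | r x (act t y)}).Nonempty ∧ BddBelow {t : ℝ | r x (act t y)} ∧
      ({t : ℝ | r (act t y) x}).Nonempty ∧ BddAbove {t : ℝ | r (act t y) x} ∧
      lminus r act x y ≤ lplus r act x y := by
  intro x y
  obtain ⟨s₀, t₀, hs₀, ht₀⟩ := hcof x y
  have key : ∀ s t : ℝ, r (act s y) x → r x (act t y) → s ≤ t := fun s t hs ht =>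
    le_of_rel_act hantisymm hactadd hflowmono hfree (htrans _ _ _ hs ht)
  exact ⟨⟨t₀, ht₀⟩, ⟨s₀, fun t ht => key s₀ t hs₀ ht⟩, ⟨s₀, hs₀⟩,
    ⟨t₀, fun s hs => key s t₀ hs ht₀⟩,
    csSup_le ⟨s₀, hs₀⟩ fun s hs => le_csInf ⟨t₀, ht₀⟩ fun t ht => key s t hs ht⟩
end

section
/- Assume the ℝ-action on X is cofinal. Then for all x, y, z ∈ X one has the triangle inequalities ℓ₊(z, x) ≤ ℓ₊(z, y) + ℓ₊(y, x) and ℓ₋(z, x) ≥ ℓ₋(z, y) + ℓ₋(y, x), and the Poincaré duality ℓ₊(x, y) = -ℓ₋(y, x). (Theorem 1.1(3)–(4) of the paper.) -/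
theorem rel_act_iff_act_neg_rel {X : Type*} {r : X → X → Prop} {act : ℝ → X → X}
    (hact0 : ∀ x, act 0 x = x)
    (hactadd : ∀ (s t : ℝ) (x : X), act (s + t) x = act s (act t x))
    (hactmono : ∀ (t : ℝ) (x y : X), r x y → r (act t x) (act t y)) (t : ℝ) (x y : X) :
    r x (act t y) ↔ r (act (-t) x) y := by
  constructor <;> intro h
  · simpa [← hactadd, hact0] using hactmono (-t) _ _ h
  · simpa [← hactadd, hact0] using hactmono t _ _ h

/-- Poincaré duality for the order spectral selectors. -/
theorem lplus_eq_neg_lminus {X : Type*} {r : X → X → Prop} {act : ℝ → X → X}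
    (hact0 : ∀ x, act 0 x = x)
    (hactadd : ∀ (s t : ℝ) (x : X), act (s + t) x = act s (act t x))
    (hactmono : ∀ (t : ℝ) (x y : X), r x y → r (act t x) (act t y)) (x y : X) :
    lplus r act x y = -lminus r act y x := by
  rw [lplus, lminus, Real.sInf_def]
  congr 2
  ext t
  simp [rel_act_iff_act_neg_rel hact0 hactadd hactmono]

theorem bddBelow_setOf_rel_act {X : Type*} {r : X → X → Prop} {act : ℝ → X → X}
    (htrans : ∀ x y z, r x y → r y z → r x z)
    (hantisymm : ∀ x y, r x y → r y x → x = y)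
    (hactadd : ∀ (s t : ℝ) (x : X), act (s + t) x = act s (act t x))
    (hflowmono : ∀ s t : ℝ, s ≤ t → ∀ x : X, r (act s x) (act t x))
    (hfree : ∀ (t : ℝ) (x : X), act t x = x → t = 0)
    {x y : X} {s : ℝ} (hs : r (act s y) x) : BddBelow {t : ℝ | r x (act t y)} := by
  refine ⟨s, fun t ht => ?_⟩
  by_contra! hlt
  have heq : act s y = act t y :=
    hantisymm _ _ (htrans _ _ _ hs ht) (hflowmono t s hlt.le y)
  have hzero : s - t = 0 := hfree (s - t) (act t y) (by rw [← hactadd, sub_add_cancel, heq])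
  linarith

theorem lplus_le_add {X : Type*} {r : X → X → Prop} {act : ℝ → X → X}
    (htrans : ∀ x y z, r x y → r y z → r x z)
    (hantisymm : ∀ x y, r x y → r y x → x = y)
    (hactadd : ∀ (s t : ℝ) (x : X), act (s + t) x = act s (act t x))
    (hactmono : ∀ (t : ℝ) (x y : X), r x y → r (act t x) (act t y))
    (hflowmono : ∀ s t : ℝ, s ≤ t → ∀ x : X, r (act s x) (act t x))
    (hfree : ∀ (t : ℝ) (x : X), act t x = x → t = 0)
    (hcof : ∀ x y : X, ∃ s t : ℝ, r (act s y) x ∧ r x (act t y)) (x y z : X) :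
    lplus r act z x ≤ lplus r act z y + lplus r act y x := by
  have hne (u v : X) : {t : ℝ | r u (act t v)}.Nonempty :=
    let ⟨_, t, _, ht⟩ := hcof u v
    ⟨t, ht⟩
  obtain ⟨s, -, hs, -⟩ := hcof z x
  have hbdd := bddBelow_setOf_rel_act htrans hantisymm hactadd hflowmono hfree hs
  have hle (a b : ℝ) (ha : r z (act a y)) (hb : r y (act b x)) : lplus r act z x ≤ a + b := by
    refine csInf_le hbdd ?_
    rw [Set.mem_ofPred_eq, hactadd]
    exact htrans _ _ _ ha (hactmono a _ _ hb)
  rw [← sub_le_iff_le_add]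
  refine le_csInf (hne z y) fun a ha => ?_
  rw [sub_le_comm]
  exact le_csInf (hne y x) fun b hb => sub_le_iff_le_add'.2 (hle a b ha hb)

/-- triangle inequalities and Poincaré duality for the
Legendrian order spectral selectors. -/
theorem stmt_15 {X : Type*} (r : X → X → Prop)
    (hrefl : ∀ x, r x x)
    (htrans : ∀ x y z, r x y → r y z → r x z)
    (hantisymm : ∀ x y, r x y → r y x → x = y)
    (act : ℝ → X → X)
    (hact0 : ∀ x, act 0 x = x)
    (hactadd : ∀ (s t : ℝ) (x : X), act (s + t) x = act s (act t x))
    (hactmono : ∀ (t : ℝ) (x y : X), r x y → r (act t x) (act t y))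
    (hflowmono : ∀ s t : ℝ, s ≤ t → ∀ x : X, r (act s x) (act t x))
    (hfree : ∀ (t : ℝ) (x : X), act t x = x → t = 0)
    (hcof : ∀ x y : X, ∃ s t : ℝ, r (act s y) x ∧ r x (act t y)) :
    ∀ x y z : X,
      lplus r act z x ≤ lplus r act z y + lplus r act y x ∧
      lminus r act z y + lminus r act y x ≤ lminus r act z x ∧
      lplus r act x y = -lminus r act y x := by
  intro x y z
  have htriangle := lplus_le_add htrans hantisymm hactadd hactmono hflowmono hfree hcof
  have hduality := lplus_eq_neg_lminus hact0 hactadd hactmono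
  refine ⟨htriangle x y z, ?_, hduality x y⟩
  have h := htriangle z y x
  simp only [hduality] at h
  linarith
end

section
/- Let X be a set with a partial order ⪯ and let G be a group acting on X by order-preserving bijections. Let T ∈ G commute with every element of G and satisfy x ⪯ T•x for every x ∈ X, and assume that for all x, y ∈ X there exists k ∈ ℕ with T⁻ᵏ•y ⪯ x and x ⪯ Tᵏ•y; define d_FPR(x, y) as the least such k. Then: d_FPR(x, y) = 0 if and only if x = y; d_FPR(x, y) = d_FPR(y, x); d_FPR(x, z) ≤ d_FPR(x, y) + d_FPR(y, z); d_FPR(g•x, g•y) = d_FPR(x, y) for every g ∈ G; and a ⪯ b and b ⪯ c imply d_FPR(a, b) ≤ d_FPR(a, c). (The Fraser–Polterovich–Rosen metric on an orderable Legendrian isotopy class is a G-invariant integer-valued metric endowing (X, ⪯) with the structure of a partially ordered metric space; Section 5.4 of the paper.) -/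
/-- The Fraser–Polterovich–Rosen distance associated to a central element `T`
moving every point non-negatively: the least `k : ℕ` with
`T⁻ᵏ•y ⪯ x` and `x ⪯ Tᵏ•y`. -/
noncomputable def dFPR {X G : Type*} [Group G] (r : X → X → Prop)
    (act : G → X → X) (T : G) (x y : X) : ℕ :=
  sInf {k : ℕ | r (act (T⁻¹ ^ k) y) x ∧ r x (act (T ^ k) y)}

section

variable {X G : Type*} [Group G] {r : X → X → Prop} {act : G → X → X} {T : G}

theorem act_inv_pow_rel_iff (hact1 : ∀ x, act 1 x = x)
    (hactmul : ∀ (g h : G) (x : X), act (g * h) x = act g (act h x))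
    (hactord : ∀ (g : G) (x y : X), r x y → r (act g x) (act g y)) (k : ℕ) (x y : X) :
    r (act (T⁻¹ ^ k) y) x ↔ r y (act (T ^ k) x) := by
  constructor
  · intro h
    have h' := hactord (T ^ k) _ _ h
    rwa [← hactmul, inv_pow, mul_inv_cancel, hact1] at h'
  · intro h
    have h' := hactord (T⁻¹ ^ k) _ _ h
    rwa [← hactmul, inv_pow, inv_mul_cancel, hact1, ← inv_pow] at h'

theorem rel_act_pow (hrefl : ∀ x, r x x) (htrans : ∀ x y z, r x y → r y z → r x z)
    (hact1 : ∀ x, act 1 x = x)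
    (hactmul : ∀ (g h : G) (x : X), act (g * h) x = act g (act h x))
    (hTpos : ∀ x : X, r x (act T x)) (k : ℕ) (x : X) : r x (act (T ^ k) x) := by
  induction k with
  | zero => simpa [hact1] using hrefl x
  | succ k ih =>
    rw [pow_succ', hactmul]
    exact htrans _ _ _ ih (hTpos _)

theorem rel_act_pow_add (htrans : ∀ x y z, r x y → r y z → r x z)
    (hactmul : ∀ (g h : G) (x : X), act (g * h) x = act g (act h x))
    (hactord : ∀ (g : G) (x y : X), r x y → r (act g x) (act g y)) {m n : ℕ} {x y z : X}
    (hxy : r x (act (T ^ m) y)) (hyz : r y (act (T ^ n) z)) : r x (act (T ^ (m + n)) z) := by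
  rw [pow_add, hactmul]
  exact htrans _ _ _ hxy (hactord _ _ _ hyz)

theorem rel_act_act_pow_iff (hact1 : ∀ x, act 1 x = x)
    (hactmul : ∀ (g h : G) (x : X), act (g * h) x = act g (act h x))
    (hactord : ∀ (g : G) (x y : X), r x y → r (act g x) (act g y))
    (hTcentral : ∀ g : G, T * g = g * T) (g : G) (k : ℕ) (x y : X) :
    r (act g x) (act (T ^ k) (act g y)) ↔ r x (act (T ^ k) y) := by
  have hcomm : T ^ k * g = g * T ^ k := (Commute.pow_left (hTcentral g) k).eq
  rw [← hactmul, hcomm, hactmul]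
  refine ⟨fun h => ?_, hactord g _ _⟩
  have h' := hactord g⁻¹ _ _ h
  rwa [← hactmul, ← hactmul, inv_mul_cancel, hact1, hact1] at h'

end

/-- the Fraser–Polterovich–Rosen metric is a `G`-invariant
integer-valued metric endowing `(X, ⪯)` with the structure of a partially
ordered metric space. -/
theorem stmt_18 {X G : Type*} [Group G] (r : X → X → Prop)
    (hrefl : ∀ x, r x x)
    (htrans : ∀ x y z, r x y → r y z → r x z)
    (hantisymm : ∀ x y, r x y → r y x → x = y)
    (act : G → X → X)
    (hact1 : ∀ x, act 1 x = x)
    (hactmul : ∀ (g h : G) (x : X), act (g * h) x = act g (act h x))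
    (hactord : ∀ (g : G) (x y : X), r x y → r (act g x) (act g y))
    (T : G)
    (hTcentral : ∀ g : G, T * g = g * T)
    (hTpos : ∀ x : X, r x (act T x))
    (hexist : ∀ x y : X, ∃ k : ℕ, r (act (T⁻¹ ^ k) y) x ∧ r x (act (T ^ k) y)) :
    (∀ x y : X, dFPR r act T x y = 0 ↔ x = y) ∧
    (∀ x y : X, dFPR r act T x y = dFPR r act T y x) ∧
    (∀ x y z : X, dFPR r act T x z ≤ dFPR r act T x y + dFPR r act T y z) ∧
    (∀ (g : G) (x y : X), dFPR r act T (act g x) (act g y) = dFPR r act T x y) ∧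
    (∀ a b c : X, r a b → r b c → dFPR r act T a b ≤ dFPR r act T a c) := by
  have hiff := act_inv_pow_rel_iff (T := T) hact1 hactmul hactord
  have hd : ∀ x y, dFPR r act T x y =
      sInf {k : ℕ | r y (act (T ^ k) x) ∧ r x (act (T ^ k) y)} := by
    intro x y
    simp only [dFPR, hiff]
  simp only [hiff] at hexist
  have hmem : ∀ x y, r y (act (T ^ dFPR r act T x y) x) ∧
      r x (act (T ^ dFPR r act T x y) y) := by
    intro x y
    rw [hd]
    exact Nat.sInf_mem (hexist x y)
  have hle : ∀ {x y : X} {k : ℕ}, r y (act (T ^ k) x) → r x (act (T ^ k) y) →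
      dFPR r act T x y ≤ k := by
    intro x y k h₁ h₂
    rw [hd]
    exact Nat.sInf_le ⟨h₁, h₂⟩
  refine ⟨fun x y => ⟨fun h => ?_, ?_⟩, fun x y => ?_, fun x y z => ?_, fun g x y => ?_,
    fun a b c hab hbc => ?_⟩
  · have hxy := hmem x y
    rw [h, pow_zero, hact1, hact1] at hxy
    exact hantisymm _ _ hxy.2 hxy.1
  · rintro rfl
    have hx : r x (act (T ^ 0) x) := by simpa [hact1] using hrefl x
    exact Nat.le_zero.mp (hle hx hx)
  · exact le_antisymm (hle (hmem y x).2 (hmem y x).1) (hle (hmem x y).2 (hmem x y).1)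
  · refine hle ?_ (rel_act_pow_add htrans hactmul hactord (hmem x y).2 (hmem y z).2)
    rw [add_comm]
    exact rel_act_pow_add htrans hactmul hactord (hmem y z).1 (hmem x y).1
  · simp only [hd, rel_act_act_pow_iff hact1 hactmul hactord hTcentral]
  · exact hle (htrans _ _ _ hbc (hmem a c).1)
      (htrans _ _ _ hab (rel_act_pow hrefl htrans hact1 hactmul hTpos _ b))
end

section
/- Let X be a set with a partial order ⪯ and let G be a group acting transitively on X by order-preserving bijections. Let T ∈ G commute with every element of G and satisfy x ⪯ T•x for every x ∈ X, and assume that for all x, y ∈ X there exists k ∈ ℕ with T⁻ᵏ•y ⪯ x and x ⪯ Tᵏ•y; define d_FPR(x, y) as the least such k. Let d be a metric on X that is G-invariant (d(g•x, g•y) = d(x, y) for all g ∈ G and x, y ∈ X) and compatible with the order (a ⪯ b and b ⪯ c imply d(a, b) ≤ d(a, c)). Fix x₀ ∈ X and set A := d(x₀, T•x₀). Then d(x, y) ≤ 3·A·d_FPR(x, y) for all x, y ∈ X. (The domination of an invariant order-compatible metric by the Fraser–Polterovich–Rosen metric, which applied to the Colin–Sandon oscillation metric yields the equivalence of the two metrics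 in Theorem 5.5 of the paper.) -/
/-- every `G`-invariant order-compatible metric on `X` is
dominated by `3·A` times the Fraser–Polterovich–Rosen metric, where
`A = d(x₀, T•x₀)`. -/
theorem stmt_19 {X G : Type*} [Group G] (r : X → X → Prop)
    (hrefl : ∀ x, r x x)
    (htrans : ∀ x y z, r x y → r y z → r x z)
    (hantisymm : ∀ x y, r x y → r y x → x = y)
    (act : G → X → X)
    (hact1 : ∀ x, act 1 x = x)
    (hactmul : ∀ (g h : G) (x : X), act (g * h) x = act g (act h x))
    (hactord : ∀ (g : G) (x y : X), r x y → r (act g x) (act g y))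
    (hacttrans : ∀ x y : X, ∃ g : G, act g x = y)
    (T : G)
    (hTcentral : ∀ g : G, T * g = g * T)
    (hTpos : ∀ x : X, r x (act T x))
    (hexist : ∀ x y : X, ∃ k : ℕ, r (act (T⁻¹ ^ k) y) x ∧ r x (act (T ^ k) y))
    (d : X → X → ℝ)
    (hd0 : ∀ x y : X, d x y = 0 ↔ x = y)
    (hdsymm : ∀ x y : X, d x y = d y x)
    (hdtri : ∀ x y z : X, d x z ≤ d x y + d y z)
    (hdinv : ∀ (g : G) (x y : X), d (act g x) (act g y) = d x y)
    (hdord : ∀ a b c : X, r a b → r b c → d a b ≤ d a c)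
    (x₀ : X) :
    ∀ x y : X, d x y ≤ 3 * d x₀ (act T x₀) * (dFPR r act T x y : ℝ) := by
  have hA : ∀ x, d x (act T x) = d x₀ (act T x₀) := by
    intro x
    obtain ⟨g, rfl⟩ := hacttrans x₀ x
    rw [← hactmul, hTcentral, hactmul, hdinv]
  have hpow : ∀ (n : ℕ) (x : X), d x (act (T ^ n) x) ≤ n * d x₀ (act T x₀) := by
    intro n x
    induction n with
    | zero => simp [hact1, (hd0 x x).2 rfl]
    | succ n ih =>
      have h := hdtri x (act (T ^ n) x) (act (T ^ (n + 1)) x)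
      rw [pow_succ' T n, hactmul, hA] at h
      rw [pow_succ', hactmul]
      push_cast
      linarith
  intro x y
  obtain ⟨hl, hu⟩ : r (act (T⁻¹ ^ dFPR r act T x y) y) x ∧
      r x (act (T ^ dFPR r act T x y) y) := Nat.sInf_mem (hexist x y)
  generalize dFPR r act T x y = k at hl hu ⊢
  obtain ⟨z, hz⟩ : ∃ z, z = act (T⁻¹ ^ k) y := ⟨_, rfl⟩
  have hy : act (T ^ k) z = y := by
    rw [hz, ← hactmul, inv_pow, mul_inv_cancel, hact1]
  rw [← hz] at hl
  have hzx := hdord z x _ hl hu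
  rw [← hy, ← hactmul, ← pow_add] at hzx
  have hzz := hpow (k + k) z
  have hzy := hpow k z
  rw [hy] at hzy
  have hxy := hdtri x z y
  rw [hdsymm x z] at hxy
  push_cast at hzz
  linarith
end
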